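/- Let λₙ∈(0,1] with λₙ→0. Let χ, b∈C_c^∞(ℝ³;ℝ), let m̃:ℝ³→ℝ be an even real symbol of order 0, let β₀=(β₀¹,β₀²) be smooth, and write (e₀)₀ = ∂_t−β₀ⁱ∂_i. Let K⊂ℝ³ be compact with supp χ contained in its interior and c>0. Let ψₙ, Nₙ be C⁴ real functions on ℝ³ and ψ₀, N₀ smooth with N₀ ≥ c on K. Assume: sup_n λₙ^{−1}(‖ψₙ−ψ₀‖_{L^∞(K)} + ‖Nₙ²−N₀²‖_{L^∞(K)}) < ∞; sup_n ‖∂ψₙ‖_{L^∞(K)} < ∞; and sup_n λₙ^{−1/2}‖∂_{x^i}(Nₙ²−N₀²)‖_{L^∞(K)} < ∞ for i=1,2 (spatial derivatives only). Then, writing Q[u] := ∫_{ℝ³} [(e₀)₀(χu)/N₀]·b·Σ_{i,j}δ^{ij}{ (Nₙ²−N₀²)·m̃((1/i)∇)(∂²_{ij}(χu)/N₀) − m̃((1/i)∇)[(Nₙ²−N₀²)·∂²_{ij}(χu)/N₀] } dx, one has Q[ψₙ] − Q[ψₙ−ψ₀] → 0 as n→∞. -/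

import Mathlib

open MeasureTheory Real Filter
open scoped ENNReal

noncomputable section

abbrev E3 : Type := Fin 3 → ℝ

/-- Partial derivative in coordinate direction `α` (direction `0` is time, `1`, `2` spatial). -/
noncomputable def pd (α : Fin 3) (f : E3 → ℝ) (x : E3) : ℝ :=
  fderiv ℝ f x (Pi.single α 1)

/-- Iterated partial derivatives along a list of directions. -/
noncomputable def pds : List (Fin 3) → (E3 → ℝ) → E3 → ℝ
  | [], f => f
  | α :: l, f => pd α (pds l f)

/-- The spatial indices `1, 2` of `Fin 3`. -/
def sp : Fin 2 → Fin 3 := ![1, 2]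

/-- The vector field `(e₀) = ∂_t − βⁱ∂_i` applied to `f`. -/
noncomputable def e0 (b : Fin 2 → E3 → ℝ) (f : E3 → ℝ) (x : E3) : ℝ :=
  pd 0 f x - (b 0 x * pd 1 f x + b 1 x * pd 2 f x)

/-- Fourier transform with the normalization `f̂(ξ) = (2π)^{−3/2} ∫ e^{−i x·ξ} f(x) dx`. -/
noncomputable def FT (f : E3 → ℂ) (ξ : E3) : ℂ :=
  (((2 * Real.pi) ^ (-(3 : ℝ) / 2) : ℝ) : ℂ) *
    ∫ x : E3, Complex.exp (-Complex.I * ((∑ α, x α * ξ α : ℝ) : ℂ)) * f x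

/-- The Fourier multiplier `m̃((1/i)∇)`, defined via the inversion formula, so that
`(m̃((1/i)∇)f)^ = m̃ · f̂`. -/
noncomputable def FMul (m : E3 → ℝ) (f : E3 → ℝ) (x : E3) : ℂ :=
  (((2 * Real.pi) ^ (-(3 : ℝ) / 2) : ℝ) : ℂ) *
    ∫ ξ : E3, Complex.exp (Complex.I * ((∑ α, x α * ξ α : ℝ) : ℂ)) * ((m ξ : ℝ) : ℂ)
      * FT (fun y => ((f y : ℝ) : ℂ)) ξ

/-- A symbol of order 0: all derivatives of order `k` decay like `(1+|ξ|)^{−k}`. -/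
def SymbolOrder0 (m : E3 → ℝ) : Prop :=
  ContDiff ℝ (⊤ : ℕ∞) m ∧
  ∀ l : List (Fin 3), ∃ C : ℝ, ∀ ξ, |pds l m ξ| ≤ C * (1 + ‖ξ‖) ^ (-(l.length : ℝ))

section Fourier

open scoped FourierTransform SchwartzMap ContDiff

variable {V : Type*} [NormedAddCommGroup V] [InnerProductSpace ℝ V] [FiniteDimensional ℝ V]
  [MeasurableSpace V] [BorelSpace V]

theorem continuous_fourier_of_integrable {f : V → ℂ} (hf : Integrable f) : Continuous (𝓕 f) :=
  VectorFourier.fourierIntegral_continuous Real.continuous_fourierChar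
    (by exact continuous_inner) hf

theorem integral_fourier_mul_eq {f g : V → ℂ} (hf : Integrable f) (hg : Integrable g) :
    ∫ ξ, 𝓕 f ξ * g ξ = ∫ x, f x * 𝓕 g x := by
  have h := VectorFourier.integral_fourierIntegral_smul_eq_flip (μ := (volume : Measure V))
    (ν := (volume : Measure V)) (L := innerₗ V) Real.continuous_fourierChar
    (by exact continuous_inner) hf hg
  rw [flip_innerₗ] at h
  exact h

theorem integral_mul_fourierInv_eq {f g : V → ℂ} (hf : Integrable f) (hg : Integrable g) :
    ∫ x, f x * 𝓕⁻ g x = ∫ ξ, 𝓕⁻ f ξ * g ξ := by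
  have h := VectorFourier.integral_fourierIntegral_smul_eq_flip (μ := (volume : Measure V))
    (ν := (volume : Measure V)) (L := -innerₗ V) Real.continuous_fourierChar
    (by exact (continuous_inner (𝕜 := ℝ) (E := V)).neg) hf hg
  have e : (-innerₗ V).flip = -innerₗ V := by
    ext x y; simp [real_inner_comm]
  rw [e] at h
  exact h.symm

/-- The integral Fourier transform of `f ∈ L¹ ∩ L²` represents its `L²` Fourier transform. -/
theorem fourier_ae_eq_fourier_toLp {f : V → ℂ} (hf : Integrable f) (hf2 : MemLp f 2) :
    𝓕 f =ᵐ[volume] (𝓕 (hf2.toLp f) : Lp ℂ 2 (volume : Measure V)) := by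
  have hg2 := Lp.memLp (𝓕 (hf2.toLp f) : Lp ℂ 2 (volume : Measure V))
  refine ae_eq_of_integral_contDiff_smul_eq
    (continuous_fourier_of_integrable hf).locallyIntegrable
    (hg2.locallyIntegrable (by norm_num)) fun g hg hgc => ?_
  have hgC : ContDiff ℝ ∞ (fun x => (g x : ℂ)) := Complex.ofRealCLM.contDiff.comp hg
  have hgcC : HasCompactSupport (fun x => (g x : ℂ)) :=
    hgc.comp_left (g := fun r : ℝ => (r : ℂ)) Complex.ofReal_zero
  let φ : 𝓢(V, ℂ) := hgcC.toSchwartzMap hgC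
  have hφ : ∀ x, φ x = (g x : ℂ) := fun x => rfl
  have key := DFunLike.congr_fun (Lp.fourier_toTemperedDistribution_eq (hf2.toLp f)) φ
  rw [TemperedDistribution.fourier_apply, Lp.toTemperedDistribution_apply,
    Lp.toTemperedDistribution_apply] at key
  have e1 : ∫ x, (𝓕 φ) x • (hf2.toLp f) x = ∫ x, f x * 𝓕 (φ : V → ℂ) x := by
    refine integral_congr_ae ?_
    filter_upwards [hf2.coeFn_toLp] with x hx
    rw [hx, smul_eq_mul, mul_comm, SchwartzMap.fourier_coe]
  rw [e1, ← integral_fourier_mul_eq hf φ.integrable] at key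
  calc ∫ x, g x • 𝓕 f x = ∫ x, 𝓕 f x * φ x := by
        refine integral_congr_ae (Eventually.of_forall fun x => ?_)
        simp [hφ, mul_comm]
    _ = _ := key
    _ = _ := by
        refine integral_congr_ae (Eventually.of_forall fun x => ?_)
        simp [hφ]

theorem memLp_two_fourier {f : V → ℂ} (hf : Integrable f) (hf2 : MemLp f 2) :
    MemLp (𝓕 f) 2 :=
  (memLp_congr_ae (fourier_ae_eq_fourier_toLp hf hf2)).2 (Lp.memLp _)

theorem eLpNorm_two_fourier {f : V → ℂ} (hf : Integrable f) (hf2 : MemLp f 2) :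
    eLpNorm (𝓕 f) 2 volume = eLpNorm f 2 volume := by
  rw [eLpNorm_congr_ae (fourier_ae_eq_fourier_toLp hf hf2), ← Lp.enorm_def,
    ← eLpNorm_congr_ae hf2.coeFn_toLp, ← Lp.enorm_def, ← ofReal_norm, ← ofReal_norm,
    Lp.norm_fourier_eq]

theorem fourier_fderiv_apply {f : V → ℂ} (hf : ContDiff ℝ 1 f) (hc : HasCompactSupport f)
    (v w : V) :
    𝓕 (fun x => fderiv ℝ f x v) w = 2 * π * Complex.I * (inner ℝ v w : ℝ) * 𝓕 f w := by
  have hi : Integrable (fderiv ℝ f) :=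
    (hf.continuous_fderiv (by norm_num)).integrable_of_hasCompactSupport (hc.fderiv ℝ)
  rw [← Real.fourier_continuousLinearMap_apply hi,
    Real.fourier_fderiv (hf.continuous.integrable_of_hasCompactSupport hc)
      (hf.differentiable (by norm_num)) hi]
  have e : (-innerSL ℝ) w v = -(inner ℝ v w : ℝ) := by
    rw [real_inner_comm]; rfl
  rw [VectorFourier.fourierSMulRight_apply, e]
  simp only [smul_eq_mul, Complex.real_smul, Complex.ofReal_neg]
  ring

theorem fourierInv_fderiv_apply {f : V → ℂ} (hf : ContDiff ℝ 1 f) (hc : HasCompactSupport f)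
    (v w : V) :
    𝓕⁻ (fun x => fderiv ℝ f x v) w = -(2 * π * Complex.I * (inner ℝ v w : ℝ) * 𝓕⁻ f w) := by
  rw [Real.fourierInv_eq_fourier_neg, fourier_fderiv_apply hf hc, Real.fourierInv_eq_fourier_neg]
  simp

theorem integrable_fourier_of_contDiff_two (hV : Module.finrank ℝ V ≤ 3)
    {f : V → ℂ} (hf : ContDiff ℝ 2 f) (hc : HasCompactSupport f) : Integrable (𝓕 f) := by
  have hf1 : ∀ v, ContDiff ℝ 1 (fun x => fderiv ℝ f x v) := fun v =>
    (hf.fderiv_right (m := 1) (by norm_num)).clm_apply contDiff_const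
  have hc1 : ∀ v, HasCompactSupport (fun x => fderiv ℝ f x v) := fun v =>
    (hc.fderiv ℝ).comp_left (g := fun L : V →L[ℝ] ℂ => L v) (by simp)
  have hf2 : ∀ v, Continuous (fun x => fderiv ℝ (fun x => fderiv ℝ f x v) x v) := fun v =>
    ((hf1 v).continuous_fderiv (by norm_num)).clm_apply continuous_const
  have hc2 : ∀ v, HasCompactSupport (fun x => fderiv ℝ (fun x => fderiv ℝ f x v) x v) := fun v =>
    ((hc1 v).fderiv ℝ).comp_left (g := fun L : V →L[ℝ] ℂ => L v) (by simp)
  have hint : Integrable f := hf.continuous.integrable_of_hasCompactSupport hc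
  have h0 : MemLp (𝓕 f) 2 :=
    memLp_two_fourier hint (hf.continuous.memLp_of_hasCompactSupport hc)
  let B := stdOrthonormalBasis ℝ V
  have h2 : ∀ i, MemLp (fun w => ((inner ℝ (B i) w : ℝ) ^ 2 : ℂ) * 𝓕 f w) 2 := fun i => by
    have := (memLp_two_fourier ((hf2 (B i)).integrable_of_hasCompactSupport (hc2 (B i)))
      ((hf2 (B i)).memLp_of_hasCompactSupport (hc2 (B i)))).const_mul
        ((2 * π * Complex.I) ^ 2 : ℂ)⁻¹
    refine (memLp_congr_ae (Eventually.of_forall fun w => ?_)).1 this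
    have h2π : (2 * π * Complex.I : ℂ) ≠ 0 := by simp [Real.pi_ne_zero]
    rw [fourier_fderiv_apply (hf1 _) (hc1 _), fourier_fderiv_apply (hf.of_le (by norm_num)) hc]
    field_simp
  have hsum : MemLp (fun w => ((1 + ‖w‖ ^ 2 : ℝ) : ℂ) * 𝓕 f w) 2 := by
    refine (memLp_congr_ae (Eventually.of_forall fun w => ?_)).1
      (h0.add (memLp_finsetSum Finset.univ (fun i _ => h2 i)))
    have : (‖w‖ ^ 2 : ℝ) = ∑ i, (inner ℝ (B i) w : ℝ) ^ 2 := by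
      rw [← B.sum_sq_norm_inner_right w]
      simp
    rw [this]
    simp [add_mul, Finset.sum_mul]
  have hw : MemLp (fun w : V => (((1 + ‖w‖ ^ 2)⁻¹ : ℝ) : ℂ)) 2 := by
    have hcont : Continuous (fun w : V => (((1 + ‖w‖ ^ 2)⁻¹ : ℝ) : ℂ)) := by
      refine Complex.continuous_ofReal.comp (Continuous.inv₀ (by fun_prop) fun w => by positivity)
    rw [memLp_two_iff_integrable_sq_norm hcont.aestronglyMeasurable]
    have := integrable_rpow_neg_one_add_norm_sq (E := V) (μ := volume) (r := 4)
      (by have : (Module.finrank ℝ V : ℝ) ≤ 3 := by exact_mod_cast hV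
          linarith)
    refine this.congr (Eventually.of_forall fun w => ?_)
    have hp : (0 : ℝ) < 1 + ‖w‖ ^ 2 := by positivity
    simp only [Complex.norm_real, norm_inv, Real.norm_eq_abs, abs_of_pos hp]
    rw [show (-4 / 2 : ℝ) = -(2 : ℕ) by norm_num, Real.rpow_neg hp.le, Real.rpow_natCast, inv_pow]
  refine (hw.integrable_mul hsum).congr (Eventually.of_forall fun w => ?_)
  have hp : ((1 + ‖w‖ ^ 2 : ℝ) : ℂ) ≠ 0 := by
    rw [Complex.ofReal_ne_zero]; positivity
  simp only [Pi.mul_apply, Complex.ofReal_inv]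
  field_simp

theorem eLpNorm_two_fourierInv {f : V → ℂ} (hf : Integrable f) (hf2 : MemLp f 2) :
    eLpNorm (𝓕⁻ f) 2 volume = eLpNorm f 2 volume := by
  rw [← eLpNorm_two_fourier hf hf2, funext (Real.fourierInv_eq_fourier_neg f)]
  exact eLpNorm_comp_measurePreserving (continuous_fourier_of_integrable hf).aestronglyMeasurable
    (Measure.measurePreserving_neg volume)

theorem continuous_fourierInv_of_integrable {f : V → ℂ} (hf : Integrable f) :
    Continuous (𝓕⁻ f) := by
  rw [funext (Real.fourierInv_eq_fourier_neg f)]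
  exact (continuous_fourier_of_integrable hf).comp continuous_neg

theorem norm_integral_mul_le_eLpNorm_two {f g : V → ℂ} (hf : MemLp f 2) (hg : MemLp g 2) :
    ‖∫ x, f x * g x‖ ≤ (eLpNorm f 2 volume).toReal * (eLpNorm g 2 volume).toReal := by
  have h : eLpNorm (f • g) 1 volume ≤ eLpNorm f 2 volume * eLpNorm g 2 volume :=
    eLpNorm_smul_le_mul_eLpNorm hg.1 hf.1
  rw [← ENNReal.toReal_mul]
  refine le_trans ?_ (ENNReal.toReal_mono (ENNReal.mul_ne_top hf.2.ne hg.2.ne) h)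
  rw [eLpNorm_one_eq_lintegral_enorm]
  have := norm_integral_le_lintegral_norm (μ := (volume : Measure V)) (fun x => f x * g x)
  simpa [ofReal_norm] using this

theorem norm_integral_fourierInv_mul_le {f g : V → ℂ} {M : V → ℝ} {C : ℝ}
    (hf : Continuous f) (hfc : HasCompactSupport f) (hg : Continuous g) (hgc : HasCompactSupport g)
    (hM : Continuous M) (hMC : ∀ w, |M w| ≤ C) :
    ‖∫ w, 𝓕⁻ f w * (M w * 𝓕 g w)‖
      ≤ C * (eLpNorm f 2 volume).toReal * (eLpNorm g 2 volume).toReal := by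
  have hC : 0 ≤ C := (abs_nonneg _).trans (hMC 0)
  have hfi := hf.integrable_of_hasCompactSupport (μ := volume) hfc
  have hgi := hg.integrable_of_hasCompactSupport (μ := volume) hgc
  have hf2 := hf.memLp_of_hasCompactSupport (μ := volume) (p := 2) hfc
  have hg2 := hg.memLp_of_hasCompactSupport (μ := volume) (p := 2) hgc
  have h1 : MemLp (𝓕⁻ f) 2 := by
    refine ⟨(continuous_fourierInv_of_integrable hfi).aestronglyMeasurable, ?_⟩
    rw [eLpNorm_two_fourierInv hfi hf2]; exact hf2.2
  have h2 : eLpNorm (fun w => (M w : ℂ) * 𝓕 g w) 2 volume ≤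
      ENNReal.ofReal C * eLpNorm (𝓕 g) 2 volume := by
    refine eLpNorm_le_mul_eLpNorm_of_ae_le_mul (Eventually.of_forall fun w => ?_) 2
    rw [norm_mul, Complex.norm_real]
    exact mul_le_mul_of_nonneg_right (hMC w) (norm_nonneg _)
  have h2f : ENNReal.ofReal C * eLpNorm (𝓕 g) 2 volume ≠ ⊤ :=
    ENNReal.mul_ne_top ENNReal.ofReal_ne_top (memLp_two_fourier hgi hg2).2.ne
  have h3 : MemLp (fun w => (M w : ℂ) * 𝓕 g w) 2 :=
    ⟨((Complex.continuous_ofReal.comp hM).mul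
      (continuous_fourier_of_integrable hgi)).aestronglyMeasurable, h2.trans_lt h2f.lt_top⟩
  refine (norm_integral_mul_le_eLpNorm_two h1 h3).trans ?_
  rw [eLpNorm_two_fourierInv hfi hf2]
  have h4 := ENNReal.toReal_mono h2f h2
  rw [ENNReal.toReal_mul, ENNReal.toReal_ofReal hC, eLpNorm_two_fourier hgi hg2] at h4
  calc _ ≤ (eLpNorm f 2 volume).toReal * (C * (eLpNorm g 2 volume).toReal) :=
        mul_le_mul_of_nonneg_left h4 ENNReal.toReal_nonneg
    _ = _ := by ring

end Fourier

section Multiplier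

open scoped FourierTransform ContDiff

/-- A real function on `E3`, viewed as a complex function on Euclidean space. -/
def complexLift (f : E3 → ℝ) (x : EuclideanSpace ℝ (Fin 3)) : ℂ := (f x.ofLp : ℂ)

theorem integral_comp_ofLp (g : E3 → ℂ) :
    ∫ x : EuclideanSpace ℝ (Fin 3), g x.ofLp = ∫ x, g x :=
  (PiLp.volume_preserving_ofLp (Fin 3)).integral_comp
    (MeasurableEquiv.toLp 2 (Fin 3 → ℝ)).symm.measurableEmbedding g

theorem FT_eq (f : E3 → ℝ) (ξ : E3) :
    FT (fun y => (f y : ℂ)) ξ = (((2 * π) ^ (-(3 : ℝ) / 2) : ℝ) : ℂ) *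
      𝓕 (complexLift f) (WithLp.toLp 2 ((2 * π)⁻¹ • ξ)) := by
  rw [FT, Real.fourier_eq', ← integral_comp_ofLp]
  congr 1
  refine integral_congr_ae (Eventually.of_forall fun x => ?_)
  simp only [complexLift, smul_eq_mul, PiLp.inner_apply, RCLike.inner_apply, conj_trivial,
    Pi.smul_apply]
  congr 2
  rw [Finset.mul_sum]
  push_cast
  rw [Finset.mul_sum, Finset.sum_mul]
  refine Finset.sum_congr rfl fun i _ => ?_
  have : (π : ℂ) ≠ 0 := by simp [Real.pi_ne_zero]
  field_simp

theorem FMul_eq (m f : E3 → ℝ) (x : E3) :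
    FMul m f x = 𝓕⁻ (fun w : EuclideanSpace ℝ (Fin 3) =>
      (m ((2 * π) • w.ofLp) : ℂ) * 𝓕 (complexLift f) w) (WithLp.toLp 2 x) := by
  have hπ : (0 : ℝ) < 2 * π := by positivity
  rw [FMul, Real.fourierInv_eq']
  have e := Measure.integral_comp_smul (volume : Measure E3)
    (fun η => Complex.exp (((2 * π * ∑ α, x α * η α : ℝ) : ℂ) * Complex.I) *
      ((m ((2 * π) • η) : ℂ) * 𝓕 (complexLift f) (WithLp.toLp 2 η))) (2 * π)⁻¹
  have e2 : (|(((2 * π)⁻¹ : ℝ) ^ Module.finrank ℝ E3)⁻¹| : ℝ) = (2 * π) ^ 3 := by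
    rw [Module.finrank_fin_fun, inv_pow, inv_inv, abs_of_pos (by positivity)]
  have e3 : ((2 * π) ^ (-(3 : ℝ) / 2) : ℝ) * ((2 * π) ^ (-(3 : ℝ) / 2) : ℝ) * (2 * π) ^ 3 = 1 := by
    rw [← Real.rpow_add hπ, ← Real.rpow_natCast, ← Real.rpow_add hπ]
    norm_num
  rw [e2] at e
  calc _ = (((2 * π) ^ (-(3 : ℝ) / 2) : ℝ) : ℂ) * ((((2 * π) ^ (-(3 : ℝ) / 2) : ℝ) : ℂ) *
        ∫ ξ : E3, Complex.exp (((2 * π * ∑ α, x α * ((2 * π)⁻¹ • ξ) α : ℝ) : ℂ) * Complex.I) *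
          ((m ((2 * π) • (2 * π)⁻¹ • ξ) : ℂ) *
            𝓕 (complexLift f) (WithLp.toLp 2 ((2 * π)⁻¹ • ξ)))) := by
        congr 1
        refine Eq.trans ?_ (integral_const_mul (μ := (volume : Measure E3))
          (((2 * π) ^ (-(3 : ℝ) / 2) : ℝ) : ℂ) _)
        refine integral_congr_ae (Eventually.of_forall fun ξ => ?_)
        simp only
        rw [FT_eq, smul_inv_smul₀ hπ.ne']
        have : 2 * π * ∑ α, x α * ((2 * π)⁻¹ • ξ) α = ∑ α, x α * ξ α := by
          rw [Finset.mul_sum]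
          refine Finset.sum_congr rfl fun i _ => ?_
          simp only [Pi.smul_apply, smul_eq_mul]
          field_simp
        rw [this, mul_comm Complex.I]
        ring
    _ = _ := by
        rw [e, ← integral_comp_ofLp, Complex.real_smul, ← mul_assoc, ← mul_assoc,
          ← Complex.ofReal_mul, ← Complex.ofReal_mul, e3, Complex.ofReal_one, one_mul]
        refine integral_congr_ae (Eventually.of_forall fun w => ?_)
        simp [PiLp.inner_apply, mul_comm]

/-- `f` is `C^k` and supported in `L`. -/
def SuppDiff (k : ℕ∞ω) (L : Set E3) (f : E3 → ℝ) : Prop :=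
  ContDiff ℝ k f ∧ tsupport f ⊆ L

variable {L : Set E3} {k : ℕ∞ω} {f g F G : E3 → ℝ} {m : E3 → ℝ}

theorem SuppDiff.of_le {j : ℕ∞ω} (hf : SuppDiff k L f) (h : j ≤ k) : SuppDiff j L f :=
  ⟨hf.1.of_le h, hf.2⟩

theorem SuppDiff.eq_zero (hf : SuppDiff k L f) {x : E3} (hx : x ∉ L) : f x = 0 :=
  image_eq_zero_of_notMem_tsupport fun h => hx (hf.2 h)

theorem SuppDiff.hasCompactSupport (hL : IsCompact L) (hf : SuppDiff k L f) :
    HasCompactSupport f :=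
  hL.of_isClosed_subset (isClosed_tsupport f) hf.2

theorem SuppDiff.add (hf : SuppDiff k L f) (hg : SuppDiff k L g) :
    SuppDiff k L (fun x => f x + g x) :=
  ⟨hf.1.add hg.1, (tsupport_add f g).trans (Set.union_subset hf.2 hg.2)⟩

theorem SuppDiff.mul_right (hf : SuppDiff k L f) (hg : ContDiff ℝ k g) :
    SuppDiff k L (fun x => f x * g x) :=
  ⟨hf.1.mul hg, tsupport_mul_subset_left.trans hf.2⟩

theorem SuppDiff.mul_left (hf : SuppDiff k L f) (hg : ContDiff ℝ k g) :
    SuppDiff k L (fun x => g x * f x) :=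
  ⟨hg.mul hf.1, tsupport_mul_subset_right.trans hf.2⟩

theorem contDiff_pd {j : ℕ∞ω} (hf : ContDiff ℝ k f) (h : j + 1 ≤ k) (α : Fin 3) :
    ContDiff ℝ j (pd α f) :=
  (hf.fderiv_right h).clm_apply contDiff_const

theorem SuppDiff.pd {j : ℕ∞ω} (hf : SuppDiff k L f) (h : j + 1 ≤ k) (α : Fin 3) :
    SuppDiff j L (pd α f) :=
  ⟨contDiff_pd hf.1 h α, (closure_mono fun x hx => support_fderiv_subset ℝ
    (f := f) (by intro h0; exact hx (by simp [_root_.pd, h0]))).trans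
      ((isClosed_tsupport f).closure_subset.trans hf.2)⟩

theorem SuppDiff.contDiff_complexLift (hf : SuppDiff k L f) : ContDiff ℝ k (complexLift f) :=
  Complex.ofRealCLM.contDiff.comp
    (hf.1.comp (EuclideanSpace.equiv (Fin 3) ℝ).toContinuousLinearMap.contDiff)

theorem SuppDiff.hasCompactSupport_complexLift (hL : IsCompact L) (hf : SuppDiff k L f) :
    HasCompactSupport (complexLift f) :=
  ((hf.hasCompactSupport hL).comp_homeomorph
    (EuclideanSpace.equiv (Fin 3) ℝ).toHomeomorph).comp_left
      (g := fun r : ℝ => (r : ℂ)) Complex.ofReal_zero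

theorem complexLift_pd (hf : ContDiff ℝ 1 f) (α : Fin 3) :
    complexLift (pd α f) =
      fun x => fderiv ℝ (complexLift f) x (EuclideanSpace.single α 1) := by
  funext x
  have h1 : HasFDerivAt f (fderiv ℝ f x.ofLp) x.ofLp :=
    (hf.differentiable (by norm_num) _).hasFDerivAt
  have h2 := Complex.ofRealCLM.hasFDerivAt.comp x (h1.comp x
    (EuclideanSpace.equiv (Fin 3) ℝ).toContinuousLinearMap.hasFDerivAt)
  have h3 : fderiv ℝ (complexLift f) x = _ := h2.fderiv
  rw [h3]
  rfl

theorem finrank_euclidean_le : Module.finrank ℝ (EuclideanSpace ℝ (Fin 3)) ≤ 3 := by simp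

theorem integrable_symbol_mul_fourier (hL : IsCompact L) (hm : Continuous m) {C : ℝ}
    (hmC : ∀ ξ, |m ξ| ≤ C) (hG : SuppDiff 2 L G) :
    Integrable (fun w : EuclideanSpace ℝ (Fin 3) =>
      (m ((2 * π) • w.ofLp) : ℂ) * 𝓕 (complexLift G) w) := by
  refine (integrable_fourier_of_contDiff_two finrank_euclidean_le hG.contDiff_complexLift
    (hG.hasCompactSupport_complexLift hL)).bdd_mul (c := C) ?_ (Eventually.of_forall fun w => ?_)
  · refine (Complex.continuous_ofReal.comp (hm.comp ?_)).aestronglyMeasurable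
    exact (EuclideanSpace.equiv (Fin 3) ℝ).continuous.const_smul (2 * π)
  · rw [Complex.norm_real]; exact hmC _

theorem continuous_FMul (hL : IsCompact L) (hm : Continuous m) {C : ℝ}
    (hmC : ∀ ξ, |m ξ| ≤ C) (hG : SuppDiff 2 L G) : Continuous (FMul m G) := by
  rw [funext (FMul_eq m G)]
  exact (continuous_fourierInv_of_integrable (integrable_symbol_mul_fourier hL hm hmC hG)).comp
    (EuclideanSpace.equiv (Fin 3) ℝ).symm.continuous

theorem integrable_mul_FMul (hL : IsCompact L) (hm : Continuous m) {C : ℝ}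
    (hmC : ∀ ξ, |m ξ| ≤ C) (hF : SuppDiff k L F) (hG : SuppDiff 2 L G) :
    Integrable (fun x => (F x : ℂ) * FMul m G x) :=
  ((Complex.continuous_ofReal.comp hF.1.continuous).mul
    (continuous_FMul hL hm hmC hG)).integrable_of_hasCompactSupport
    (((hF.hasCompactSupport hL).comp_left (g := fun r : ℝ => (r : ℂ))
      Complex.ofReal_zero).mul_right)

/-- The bilinear form `∫ F · m̃((1/i)∇)G`. -/
def mulForm (m F G : E3 → ℝ) : ℂ := ∫ x, (F x : ℂ) * FMul m G x

theorem mulForm_eq (hL : IsCompact L) (hm : Continuous m) {C : ℝ}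
    (hmC : ∀ ξ, |m ξ| ≤ C) (hF : SuppDiff k L F) (hG : SuppDiff 2 L G) :
    mulForm m F G = ∫ w : EuclideanSpace ℝ (Fin 3), 𝓕⁻ (complexLift F) w *
      ((m ((2 * π) • w.ofLp) : ℂ) * 𝓕 (complexLift G) w) := by
  rw [mulForm, ← integral_mul_fourierInv_eq
    (hF.contDiff_complexLift.continuous.integrable_of_hasCompactSupport
      (hF.hasCompactSupport_complexLift hL))
    (integrable_symbol_mul_fourier hL hm hmC hG), ← integral_comp_ofLp]
  refine integral_congr_ae (Eventually.of_forall fun x => ?_)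
  simp only [FMul_eq]
  rfl

theorem FMul_add (hL : IsCompact L) (hm : Continuous m) {C : ℝ} (hmC : ∀ ξ, |m ξ| ≤ C)
    (hF : SuppDiff 2 L F) (hG : SuppDiff 2 L G) (x : E3) :
    FMul m (fun y => F y + G y) x = FMul m F x + FMul m G x := by
  have hi : ∀ {H : E3 → ℝ}, SuppDiff 2 L H → Integrable (complexLift H) := fun h =>
    h.contDiff_complexLift.continuous.integrable_of_hasCompactSupport
      (h.hasCompactSupport_complexLift hL)
  have e : (complexLift fun y => F y + G y) = complexLift F + complexLift G := by
    funext y; simp [complexLift]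
  have e2 : 𝓕 (complexLift F + complexLift G) = 𝓕 (complexLift F) + 𝓕 (complexLift G) :=
    (VectorFourier.fourierIntegral_add
      (μ := (volume : Measure (EuclideanSpace ℝ (Fin 3)))) (L := innerₗ _)
      Real.continuous_fourierChar
      (by exact continuous_inner (𝕜 := ℝ) (E := EuclideanSpace ℝ (Fin 3)))
      (hi hF) (hi hG))
  have e3 := congrFun (VectorFourier.fourierIntegral_add
    (μ := (volume : Measure (EuclideanSpace ℝ (Fin 3)))) (L := -innerₗ _)
    Real.continuous_fourierChar
    (by exact (continuous_inner (𝕜 := ℝ) (E := EuclideanSpace ℝ (Fin 3))).neg)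
    (integrable_symbol_mul_fourier hL hm hmC hF)
    (integrable_symbol_mul_fourier hL hm hmC hG)) (WithLp.toLp 2 x)
  rw [FMul_eq, FMul_eq, FMul_eq, e, e2]
  refine Eq.trans ?_ e3
  simp only [Pi.add_apply, mul_add]
  rfl

theorem mulForm_add_right (hL : IsCompact L) (hm : Continuous m) {C : ℝ}
    (hmC : ∀ ξ, |m ξ| ≤ C) {F G G' : E3 → ℝ} (hF : SuppDiff k L F) (hG : SuppDiff 2 L G)
    (hG' : SuppDiff 2 L G') :
    mulForm m F (fun x => G x + G' x) = mulForm m F G + mulForm m F G' := by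
  rw [mulForm, mulForm, mulForm, ← integral_add (integrable_mul_FMul hL hm hmC hF hG)
    (integrable_mul_FMul hL hm hmC hF hG')]
  simp only [FMul_add hL hm hmC hG hG', mul_add]

theorem mulForm_add_left (hL : IsCompact L) (hm : Continuous m) {C : ℝ}
    (hmC : ∀ ξ, |m ξ| ≤ C) {F F' G : E3 → ℝ} (hF : SuppDiff k L F) (hF' : SuppDiff k L F')
    (hG : SuppDiff 2 L G) :
    mulForm m (fun x => F x + F' x) G = mulForm m F G + mulForm m F' G := by
  rw [mulForm, mulForm, mulForm, ← integral_add (integrable_mul_FMul hL hm hmC hF hG)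
    (integrable_mul_FMul hL hm hmC hF' hG)]
  simp only [Complex.ofReal_add, add_mul]

/-- Integration by parts: `m̃((1/i)∇)` commutes with constant-coefficient derivatives. -/
theorem mulForm_pd_right (hL : IsCompact L) (hm : Continuous m) {C : ℝ}
    (hmC : ∀ ξ, |m ξ| ≤ C) (hF : SuppDiff 3 L F) (hG : SuppDiff 3 L G) (α : Fin 3) :
    mulForm m F (pd α G) = -mulForm m (pd α F) G := by
  have h2 : (2 : ℕ∞ω) ≤ 3 := by norm_num
  have h1 : (1 : ℕ∞ω) ≤ 3 := by norm_num
  rw [mulForm_eq hL hm hmC hF (hG.pd (by norm_num) α),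
    mulForm_eq hL hm hmC (hF.pd (j := 2) (by norm_num) α) (hG.of_le h2), ← integral_neg,
    complexLift_pd (hF.1.of_le h1), complexLift_pd (hG.1.of_le h1)]
  refine integral_congr_ae (Eventually.of_forall fun w => ?_)
  simp only
  rw [fourier_fderiv_apply (hG.of_le h1).contDiff_complexLift (hG.hasCompactSupport_complexLift hL),
    fourierInv_fderiv_apply (hF.of_le h1).contDiff_complexLift (hF.hasCompactSupport_complexLift hL)]
  ring

theorem SuppDiff.eLpNorm_complexLift_le (hL : IsCompact L) {a : ℝ} (ha : 0 ≤ a)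
    (hF : SuppDiff k L F) (hFa : ∀ x ∈ L, |F x| ≤ a) :
    (eLpNorm (complexLift F) 2 volume).toReal ≤
      a * ((volume L) ^ (1 / (2 : ℝ≥0∞).toReal)).toReal := by
  have hLm : MeasurableSet L := hL.isClosed.measurableSet
  have e : eLpNorm (complexLift F) 2 volume = eLpNorm (fun x => (F x : ℂ)) 2 volume :=
    eLpNorm_comp_measurePreserving
      (Complex.continuous_ofReal.comp hF.1.continuous).aestronglyMeasurable
      (PiLp.volume_preserving_ofLp (Fin 3))
  have h : eLpNorm (fun x => (F x : ℂ)) 2 volume ≤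
      eLpNorm (L.indicator fun _ => a) 2 volume := by
    refine eLpNorm_mono fun x => ?_
    by_cases hx : x ∈ L
    · rw [Set.indicator_of_mem hx, Complex.norm_real, Real.norm_eq_abs, Real.norm_eq_abs]
      exact (hFa x hx).trans (le_abs_self a)
    · simp [hF.eq_zero hx]
  rw [eLpNorm_indicator_const hLm (by norm_num) (by norm_num)] at h
  have hfin : (volume L) ^ (1 / (2 : ℝ≥0∞).toReal) ≠ ⊤ :=
    ENNReal.rpow_ne_top_of_nonneg (by positivity) hL.measure_lt_top.ne
  rw [e]
  refine (ENNReal.toReal_mono (ENNReal.mul_ne_top (by simp) hfin) h).trans_eq ?_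
  rw [ENNReal.toReal_mul, toReal_enorm, Real.norm_eq_abs, abs_of_nonneg ha]

theorem exists_norm_mulForm_le (hL : IsCompact L) (hm : Continuous m) {C : ℝ}
    (hmC : ∀ ξ, |m ξ| ≤ C) :
    ∃ M, 0 ≤ M ∧ ∀ F G : E3 → ℝ, ∀ a a' : ℝ, 0 ≤ a → 0 ≤ a' → SuppDiff 2 L F → SuppDiff 2 L G →
      (∀ x ∈ L, |F x| ≤ a) → (∀ x ∈ L, |G x| ≤ a') → ‖mulForm m F G‖ ≤ M * (a * a') := by
  have hC : 0 ≤ C := (abs_nonneg _).trans (hmC 0)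
  set v := ((volume L) ^ (1 / (2 : ℝ≥0∞).toReal)).toReal
  have hv : 0 ≤ v := ENNReal.toReal_nonneg
  refine ⟨C * v * v, by positivity, fun F G a a' ha ha' hF hG hFa hGa => ?_⟩
  rw [mulForm_eq hL hm hmC hF hG]
  have hM : Continuous fun w : EuclideanSpace ℝ (Fin 3) => m ((2 * π) • w.ofLp) :=
    hm.comp ((EuclideanSpace.equiv (Fin 3) ℝ).continuous.const_smul (2 * π))
  refine (norm_integral_fourierInv_mul_le hF.contDiff_complexLift.continuous
    (hF.hasCompactSupport_complexLift hL) hG.contDiff_complexLift.continuous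
    (hG.hasCompactSupport_complexLift hL) hM (fun w => hmC _)).trans ?_
  calc _ ≤ C * (a * v) * (a' * v) := by
        gcongr
        · exact hF.eLpNorm_complexLift_le hL ha hFa
        · exact hG.eLpNorm_complexLift_le hL ha' hGa
    _ = _ := by ring

end Multiplier

section Commutator

open scoped ContDiff

variable {L : Set E3} {k : ℕ∞ω} {f g F G h : E3 → ℝ} {m : E3 → ℝ} {C : ℝ}

theorem pd_add (hf : Differentiable ℝ f) (hg : Differentiable ℝ g) (α : Fin 3) (x : E3) :
    pd α (fun y => f y + g y) x = pd α f x + pd α g x := by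
  rw [pd, fderiv_fun_add (hf x) (hg x)]
  rfl

theorem pd_mul (hf : Differentiable ℝ f) (hg : Differentiable ℝ g) (α : Fin 3) (x : E3) :
    pd α (fun y => f y * g y) x = f x * pd α g x + g x * pd α f x := by
  rw [pd, fderiv_fun_mul (hf x) (hg x)]
  rfl

theorem SuppDiff.sub (hf : SuppDiff k L f) (hg : SuppDiff k L g) :
    SuppDiff k L (fun x => f x - g x) :=
  ⟨hf.1.sub hg.1, (tsupport_sub f g).trans (Set.union_subset hf.2 hg.2)⟩

theorem SuppDiff.div (hf : SuppDiff k L f) (hg : ContDiff ℝ k g) (h0 : ∀ x ∈ L, g x ≠ 0) :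
    SuppDiff k L (fun x => f x / g x) := by
  refine ⟨contDiff_iff_contDiffAt.2 fun x => ?_, ?_⟩
  · by_cases hx : x ∈ tsupport f
    · exact hf.1.contDiffAt.div hg.contDiffAt (h0 x (hf.2 hx))
    · refine (contDiffAt_const (c := (0 : ℝ))).congr_of_eventuallyEq ?_
      filter_upwards [notMem_tsupport_iff_eventuallyEq.1 hx] with y hy
      simp [hy]
  · simp only [div_eq_mul_inv]
    exact tsupport_mul_subset_left.trans hf.2

theorem pd_div_add (hf : SuppDiff 1 L f) (hg : ContDiff ℝ 1 g) (h0 : ∀ x ∈ L, g x ≠ 0)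
    (α : Fin 3) (x : E3) :
    pd α f x / g x = pd α (fun y => f y / g y) x + f x * pd α g x / g x ^ 2 := by
  have hd := (hf.div hg h0).1.differentiable one_ne_zero
  have hgd := hg.differentiable one_ne_zero
  have hfg : (fun y => f y / g y * g y) = f := by
    funext y
    by_cases hy : y ∈ L
    · exact div_mul_cancel₀ _ (h0 y hy)
    · simp [hf.eq_zero hy]
  have h := pd_mul hd hgd α x
  rw [hfg] at h
  by_cases hx : x ∈ L
  · have := h0 x hx
    rw [h]
    field_simp
    ring
  · rw [(hf.pd (j := 0) (by simp) α).eq_zero hx,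
      ((hf.div hg h0).pd (j := 0) (by simp) α).eq_zero hx, hf.eq_zero hx]
    simp

theorem exists_abs_le_of_continuousOn (hL : IsCompact L) (hf : ContinuousOn f L) :
    ∃ B, 0 ≤ B ∧ ∀ x ∈ L, |f x| ≤ B := by
  obtain ⟨B, hB⟩ := hL.exists_bound_of_continuousOn hf
  exact ⟨|B|, abs_nonneg _, fun x hx => (hB x hx).trans (le_abs_self B)⟩

/-- The trilinear form `∫ F · [h, m̃((1/i)∇)] G`. -/
def commForm (m F h G : E3 → ℝ) : ℂ :=
  mulForm m (fun x => F x * h x) G - mulForm m F (fun x => h x * G x)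

theorem commForm_add_left (hL : IsCompact L) (hm : Continuous m) (hmC : ∀ ξ, |m ξ| ≤ C)
    {F F' : E3 → ℝ} (hF : SuppDiff 2 L F) (hF' : SuppDiff 2 L F') (hh : ContDiff ℝ 2 h)
    (hG : SuppDiff 2 L G) :
    commForm m (fun x => F x + F' x) h G = commForm m F h G + commForm m F' h G := by
  simp only [commForm, add_mul]
  rw [mulForm_add_left hL hm hmC (hF.mul_right hh) (hF'.mul_right hh) hG,
    mulForm_add_left hL hm hmC hF hF' (hG.mul_left hh)]
  ring

theorem commForm_add_right (hL : IsCompact L) (hm : Continuous m) (hmC : ∀ ξ, |m ξ| ≤ C)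
    {G G' : E3 → ℝ} (hF : SuppDiff 2 L F) (hh : ContDiff ℝ 2 h)
    (hG : SuppDiff 2 L G) (hG' : SuppDiff 2 L G') :
    commForm m F h (fun x => G x + G' x) = commForm m F h G + commForm m F h G' := by
  simp only [commForm, mul_add]
  rw [mulForm_add_right hL hm hmC (hF.mul_right hh) hG hG',
    mulForm_add_right hL hm hmC hF (hG.mul_left hh) (hG'.mul_left hh)]
  ring

theorem exists_norm_commForm_le (hL : IsCompact L) (hm : Continuous m) (hmC : ∀ ξ, |m ξ| ≤ C) :
    ∃ M, 0 ≤ M ∧ ∀ F h G : E3 → ℝ, ∀ a s a' : ℝ, 0 ≤ a → 0 ≤ s → 0 ≤ a' →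
      SuppDiff 2 L F → ContDiff ℝ 2 h → SuppDiff 2 L G →
      (∀ x ∈ L, |F x| ≤ a) → (∀ x ∈ L, |h x| ≤ s) → (∀ x ∈ L, |G x| ≤ a') →
      ‖commForm m F h G‖ ≤ M * (a * s * a') := by
  obtain ⟨M, hM, hb⟩ := exists_norm_mulForm_le hL hm hmC
  refine ⟨2 * M, by positivity, fun F h G a s a' ha hs ha' hF hh hG hFa hhs hGa => ?_⟩
  have h1 := hb (fun x => F x * h x) G (a * s) a' (by positivity) ha' (hF.mul_right hh) hG
    (fun x hx => by
      rw [abs_mul]; exact mul_le_mul (hFa x hx) (hhs x hx) (abs_nonneg _) ha) hGa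
  have h2 := hb F (fun x => h x * G x) a (s * a') ha (by positivity) hF (hG.mul_left hh) hFa
    (fun x hx => by
      rw [abs_mul]; exact mul_le_mul (hhs x hx) (hGa x hx) (abs_nonneg _) hs)
  refine (norm_sub_le _ _).trans ((add_le_add h1 h2).trans_eq ?_)
  ring

/-- For fixed smooth `f` and `g`, the commutator form tested against `∂w / g` only costs one
derivative of `h` in the same direction, and no derivative of `w`. -/
theorem exists_norm_commForm_pd_div_le (hL : IsCompact L) (hm : Continuous m)
    (hmC : ∀ ξ, |m ξ| ≤ C) (hf : SuppDiff 3 L f) (hg : ContDiff ℝ 4 g) (hg0 : ∀ x ∈ L, g x ≠ 0)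
    (α : Fin 3) :
    ∃ M, 0 ≤ M ∧ ∀ h w : E3 → ℝ, ∀ s a : ℝ, 0 ≤ s → 0 ≤ a →
      ContDiff ℝ 4 h → SuppDiff 3 L w → (∀ x ∈ L, |h x| ≤ s) → (∀ x ∈ L, |pd α h x| ≤ s) →
      (∀ x ∈ L, |w x| ≤ a) →
      ‖commForm m f h (fun x => pd α w x / g x)‖ ≤ M * (s * a) := by
  have h34 : (3 : ℕ∞ω) ≤ 4 := by norm_num
  have h23 : (2 : ℕ∞ω) ≤ 3 := by norm_num
  have h13 : (1 : ℕ∞ω) ≤ 3 := by norm_num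
  have hgpd : ContDiff ℝ 3 (pd α g) := contDiff_pd hg (by norm_num) α
  have hg3 := hg.of_le h34
  have hfpd : SuppDiff 2 L (pd α f) := hf.pd (by norm_num) α
  obtain ⟨M, hM, hb⟩ := exists_norm_mulForm_le hL hm hmC
  obtain ⟨A₁, hA₁, hfA⟩ := exists_abs_le_of_continuousOn hL hf.1.continuous.continuousOn
  obtain ⟨A₂, hA₂, hfpdA⟩ := exists_abs_le_of_continuousOn hL hfpd.1.continuous.continuousOn
  obtain ⟨B₁, hB₁, hgB⟩ := exists_abs_le_of_continuousOn hL (f := fun x => (g x)⁻¹)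
    (hg.continuous.continuousOn.inv₀ hg0)
  obtain ⟨B₂, hB₂, hgpdB⟩ := exists_abs_le_of_continuousOn hL (f := fun x => pd α g x / g x ^ 2)
    (hgpd.continuous.continuousOn.div (hg.continuous.pow 2).continuousOn
      fun x hx => pow_ne_zero 2 (hg0 x hx))
  refine ⟨M * ((A₁ + A₂) * B₁ + A₁ * B₂ + (A₂ * B₁ + A₁ * B₁ + A₁ * B₂)), by positivity,
    fun h w s a hs ha hh hw hhs hhpds hwa => ?_⟩
  have hhpd : ContDiff ℝ 3 (pd α h) := contDiff_pd hh (by norm_num) α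
  have hh3 := hh.of_le h34
  have hh2 := hh3.of_le h23
  have hP : SuppDiff 3 L (fun x => w x / g x) := hw.div hg3 hg0
  have hR : SuppDiff 3 L (fun x => w x * pd α g x / g x ^ 2) :=
    (hw.mul_right hgpd).div (hg3.pow 2) fun x hx => pow_ne_zero 2 (hg0 x hx)
  set P := fun x => w x / g x with hPdef
  set R := fun x => w x * pd α g x / g x ^ 2 with hRdef
  have hPpd : SuppDiff 2 L (pd α P) := hP.pd (by norm_num) α
  have hPb : ∀ x ∈ L, |P x| ≤ a * B₁ := fun x hx => by
    rw [hPdef]; simp only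
    rw [div_eq_mul_inv, abs_mul]
    exact mul_le_mul (hwa x hx) (hgB x hx) (abs_nonneg _) ha
  have hRb : ∀ x ∈ L, |R x| ≤ a * B₂ := fun x hx => by
    rw [hRdef]; simp only
    rw [mul_div_assoc, abs_mul]
    exact mul_le_mul (hwa x hx) (hgpdB x hx) (abs_nonneg _) ha
  have hmulb : ∀ {u v : E3 → ℝ} {c d : ℝ}, 0 ≤ c → (∀ x ∈ L, |u x| ≤ c) → (∀ x ∈ L, |v x| ≤ d) →
      ∀ x ∈ L, |u x * v x| ≤ c * d := fun hc hu hv x hx => by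
    rw [abs_mul]; exact mul_le_mul (hu x hx) (hv x hx) (abs_nonneg _) hc
  have e1 : (fun x => pd α w x / g x) = fun x => pd α P x + R x :=
    funext fun x => pd_div_add (hw.of_le h13) (hg3.of_le h13) hg0 α x
  have hhP : SuppDiff 3 L (fun x => h x * P x) := hP.mul_left hh3
  have hfh : SuppDiff 3 L (fun x => f x * h x) := hf.mul_right hh3
  have hdP : SuppDiff 2 L (fun x => -pd α h x * P x) :=
    (hP.of_le h23).mul_left (hhpd.of_le h23).neg
  have e2 : (fun x => h x * (pd α P x + R x)) = fun x =>
      pd α (fun y => h y * P y) x + (-pd α h x * P x + h x * R x) := by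
    funext x
    rw [pd_mul ((hh3.of_le h13).differentiable one_ne_zero)
      ((hP.1.of_le h13).differentiable one_ne_zero)]
    ring
  have key : commForm m f h (fun x => pd α w x / g x) =
      -mulForm m (pd α fun x => f x * h x) P + mulForm m (fun x => f x * h x) R
      - (-mulForm m (pd α f) (fun x => h x * P x) + (mulForm m f (fun x => -pd α h x * P x)
        + mulForm m f (fun x => h x * R x))) := by
    rw [e1, commForm, e2, mulForm_add_right hL hm hmC hfh hPpd (hR.of_le h23),
      mulForm_pd_right hL hm hmC hfh hP,
      mulForm_add_right hL hm hmC hf (hhP.pd (by norm_num) α)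
        (hdP.add ((hR.of_le h23).mul_left hh2)),
      mulForm_pd_right hL hm hmC hf hhP,
      mulForm_add_right hL hm hmC hf hdP ((hR.of_le h23).mul_left hh2)]
  have hfhpdb : ∀ x ∈ L, |pd α (fun y => f y * h y) x| ≤ (A₁ + A₂) * s := fun x hx => by
    rw [pd_mul ((hf.1.of_le h13).differentiable one_ne_zero)
      ((hh3.of_le h13).differentiable one_ne_zero)]
    have b1 := hmulb hA₁ hfA hhpds x hx
    have b2 := hmulb hs hhs hfpdA x hx
    refine (abs_add_le _ _).trans ((add_le_add b1 b2).trans_eq (by ring))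
  have t1 := hb _ _ _ _ (by positivity) (by positivity) (hfh.pd (by norm_num) α) (hP.of_le h23)
    hfhpdb hPb
  have t2 := hb _ _ _ _ (mul_nonneg hA₁ hs) (by positivity) (hfh.of_le h23) (hR.of_le h23)
    (hmulb hA₁ hfA hhs) hRb
  have t3 := hb _ _ _ _ hA₂ (by positivity) hfpd (hhP.of_le h23)
    hfpdA (hmulb hs hhs hPb)
  have t4 := hb _ _ _ _ hA₁ (by positivity) (hf.of_le h23) hdP
    hfA (hmulb (u := fun x => -pd α h x) hs (by simpa using hhpds) hPb)
  have t5 := hb _ _ _ _ hA₁ (by positivity) (hf.of_le h23) ((hR.of_le h23).mul_left hh2)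
    hfA (hmulb hs hhs hRb)
  rw [key]
  calc _ ≤ ‖mulForm m (pd α fun x => f x * h x) P‖ + ‖mulForm m (fun x => f x * h x) R‖
        + (‖mulForm m (pd α f) (fun x => h x * P x)‖ + (‖mulForm m f (fun x => -pd α h x * P x)‖
        + ‖mulForm m f (fun x => h x * R x)‖)) := by
        refine (norm_sub_le _ _).trans (add_le_add ((norm_add_le _ _).trans ?_)
          ((norm_add_le _ _).trans (add_le_add ?_ (norm_add_le _ _))))
        · rw [norm_neg]
        · rw [norm_neg]
    _ ≤ _ := add_le_add (add_le_add t1 t2) (add_le_add t3 (add_le_add t4 t5))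
    _ = _ := by ring

/-- The coefficient `(e₀u / N₀) b` of the commutator. -/
def amplitude (b₀ : Fin 2 → E3 → ℝ) (N₀ b u : E3 → ℝ) (x : E3) : ℝ :=
  e0 b₀ u x / N₀ x * b x

/-- The rescaled second derivative `∂²ᵢᵢu / N₀`. -/
def hessDiag (N₀ u : E3 → ℝ) (i : Fin 2) (x : E3) : ℝ :=
  pd (sp i) (pd (sp i) u) x / N₀ x

variable {b₀ : Fin 2 → E3 → ℝ} {N₀ b u v : E3 → ℝ}

theorem SuppDiff.amplitude (hu : SuppDiff 4 L u) (hb₀ : ∀ i, ContDiff ℝ 3 (b₀ i))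
    (hN : ContDiff ℝ 3 N₀) (hN0 : ∀ x ∈ L, N₀ x ≠ 0) (hb : ContDiff ℝ 3 b) :
    SuppDiff 3 L (amplitude b₀ N₀ b u) := by
  have hp : ∀ α, SuppDiff 3 L (_root_.pd α u) := fun α => hu.pd (by norm_num) α
  exact (((hp 0).sub (((hp 1).mul_left (hb₀ 0)).add ((hp 2).mul_left (hb₀ 1)))).div hN
    hN0).mul_right hb

theorem SuppDiff.hessDiag (hu : SuppDiff 4 L u) (hN : ContDiff ℝ 2 N₀)
    (hN0 : ∀ x ∈ L, N₀ x ≠ 0) (i : Fin 2) : SuppDiff 2 L (hessDiag N₀ u i) :=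
  ((hu.pd (j := 3) (by norm_num) _).pd (by norm_num) _).div hN hN0

theorem amplitude_add (hu : Differentiable ℝ u) (hv : Differentiable ℝ v) :
    amplitude b₀ N₀ b (fun x => u x + v x) =
      fun x => amplitude b₀ N₀ b u x + amplitude b₀ N₀ b v x := by
  funext x
  simp only [amplitude, e0, pd_add hu hv]
  ring

theorem hessDiag_add (hu : ContDiff ℝ 2 u) (hv : ContDiff ℝ 2 v) (i : Fin 2) :
    hessDiag N₀ (fun x => u x + v x) i = fun x => hessDiag N₀ u i x + hessDiag N₀ v i x := by
  funext x
  have h2 : (2 : ℕ∞ω) ≠ 0 := by norm_num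
  simp only [hessDiag]
  rw [show pd (sp i) (fun x => u x + v x) = fun x => pd (sp i) u x + pd (sp i) v x from
    funext (pd_add (hu.differentiable h2) (hv.differentiable h2) _),
    pd_add ((contDiff_pd hu (j := 1) (by norm_num) _).differentiable one_ne_zero)
      ((contDiff_pd hv (j := 1) (by norm_num) _).differentiable one_ne_zero), add_div]

theorem exists_abs_amplitude_le (hL : IsCompact L) (hb₀ : ∀ i, Continuous (b₀ i))
    (hN : Continuous N₀) (hN0 : ∀ x ∈ L, N₀ x ≠ 0) (hb : Continuous b) :
    ∃ M, 0 ≤ M ∧ ∀ (u : E3 → ℝ) (D : ℝ), 0 ≤ D → (∀ α, ∀ x ∈ L, |pd α u x| ≤ D) →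
      ∀ x ∈ L, |amplitude b₀ N₀ b u x| ≤ M * D := by
  obtain ⟨B₀, hB₀, h₀⟩ := exists_abs_le_of_continuousOn hL (hb₀ 0).continuousOn
  obtain ⟨B₁, hB₁, h₁⟩ := exists_abs_le_of_continuousOn hL (hb₀ 1).continuousOn
  obtain ⟨B, hB, h⟩ := exists_abs_le_of_continuousOn hL (f := fun x => b x / N₀ x)
    (hb.continuousOn.div hN.continuousOn hN0)
  refine ⟨(1 + (B₀ + B₁)) * B, by positivity, fun u D hD hu x hx => ?_⟩
  have hmul : ∀ i {c}, 0 ≤ c → |b₀ i x| ≤ c → ∀ α, |b₀ i x * pd α u x| ≤ c * D :=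
    fun i c hc hi α => by rw [abs_mul]; exact mul_le_mul hi (hu α x hx) (abs_nonneg _) hc
  have he : |e0 b₀ u x| ≤ (1 + (B₀ + B₁)) * D :=
    calc _ ≤ D + (B₀ * D + B₁ * D) := (abs_sub _ _).trans (add_le_add (hu 0 x hx)
          ((abs_add_le _ _).trans (add_le_add (hmul 0 hB₀ (h₀ x hx) 1) (hmul 1 hB₁ (h₁ x hx) 2))))
      _ = _ := by ring
  calc |amplitude b₀ N₀ b u x| = |e0 b₀ u x| * |b x / N₀ x| := by
        rw [← abs_mul, amplitude, div_mul_eq_mul_div, mul_div_assoc]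
    _ ≤ (1 + (B₀ + B₁)) * D * B :=
        mul_le_mul he (h x hx) (abs_nonneg _) (by positivity)
    _ = _ := by ring

theorem integral_commutator_eq (hL : IsCompact L) (hm : Continuous m) (hmC : ∀ ξ, |m ξ| ≤ C)
    (hu : SuppDiff 4 L u) (hb₀ : ∀ i, ContDiff ℝ 3 (b₀ i)) (hN : ContDiff ℝ 3 N₀)
    (hN0 : ∀ x ∈ L, N₀ x ≠ 0) (hb : ContDiff ℝ 3 b) (hh : ContDiff ℝ 4 h) :
    ∫ x : E3, ((e0 b₀ u x / N₀ x : ℝ) : ℂ) * ((b x : ℝ) : ℂ) *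
      ∑ i : Fin 2, (((h x : ℝ) : ℂ) * FMul m (fun y => pd (sp i) (pd (sp i) u) y / N₀ y) x
        - FMul m (fun y => h y * pd (sp i) (pd (sp i) u) y / N₀ y) x) =
    ∑ i : Fin 2, commForm m (amplitude b₀ N₀ b u) h (hessDiag N₀ u i) := by
  have hA := hu.amplitude hb₀ hN hN0 hb
  have hH := fun i => hu.hessDiag (hN.of_le (by norm_num)) hN0 i
  have hh2 : ContDiff ℝ 2 h := hh.of_le (by norm_num)
  have hh3 : ContDiff ℝ 3 h := hh.of_le (by norm_num)
  have i1 := fun i => integrable_mul_FMul hL hm hmC (hA.mul_right hh3) (hH i)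
  have i2 := fun i => integrable_mul_FMul hL hm hmC hA ((hH i).mul_left hh2)
  have e : ∀ i, commForm m (amplitude b₀ N₀ b u) h (hessDiag N₀ u i) = _ := fun i =>
    (integral_sub (i1 i) (i2 i)).symm
  simp only [e]
  refine Eq.trans ?_ (integral_finsetSum Finset.univ fun i _ => (i1 i).sub (i2 i))
  refine integral_congr_ae (Eventually.of_forall fun x => ?_)
  simp only [Finset.mul_sum]
  refine Finset.sum_congr rfl fun i _ => ?_
  have e3 : (fun y => h y * pd (sp i) (pd (sp i) u) y / N₀ y) =
      fun y => h y * hessDiag N₀ u i y := funext fun y => mul_div_assoc _ _ _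
  rw [e3]
  change _ * (_ * FMul m (hessDiag N₀ u i) x - _) = _
  simp only [amplitude]
  push_cast
  ring

theorem SymbolOrder0.exists_abs_le (hm : SymbolOrder0 m) : ∃ C, ∀ ξ, |m ξ| ≤ C := by
  obtain ⟨C, hC⟩ := hm.2 []
  exact ⟨C, fun ξ => by simpa [pds] using hC ξ⟩

end Commutator

/-- Proposition `prop:reduction.to.diff` of Huneau–Luk: in the elliptic-wave
trilinear commutator term, replacing `ψₙ` by `ψₙ − ψ₀` does not change the limit. -/
theorem stmt16
    (lam : ℕ → ℝ) (hlam : ∀ n, lam n ∈ Set.Ioc (0 : ℝ) 1)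
    (hlam0 : Tendsto lam atTop (nhds 0))
    (χ b : E3 → ℝ)
    (hχ : ContDiff ℝ (⊤ : ℕ∞) χ) (hχc : HasCompactSupport χ)
    (hb : ContDiff ℝ (⊤ : ℕ∞) b) (hbc : HasCompactSupport b)
    (m : E3 → ℝ) (hm : SymbolOrder0 m) (hmeven : ∀ ξ, m (-ξ) = m ξ)
    (b₀ : Fin 2 → E3 → ℝ) (hb₀ : ∀ i, ContDiff ℝ (⊤ : ℕ∞) (b₀ i))
    (K : Set E3) (hK : IsCompact K) (hχK : tsupport χ ⊆ interior K)
    (c : ℝ) (hc : 0 < c)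
    (ψ Nn : ℕ → E3 → ℝ) (ψ₀ N₀ : E3 → ℝ)
    (hreg : ∀ n, ContDiff ℝ 4 (ψ n) ∧ ContDiff ℝ 4 (Nn n))
    (hlimreg : ContDiff ℝ (⊤ : ℕ∞) ψ₀ ∧ ContDiff ℝ (⊤ : ℕ∞) N₀)
    (hN₀c : ∀ x ∈ K, c ≤ N₀ x)
    -- O(λₙ) closeness in L^∞(K)
    (hclose : ∃ C : ℝ, ∀ n, ∀ x ∈ K,
      |ψ n x - ψ₀ x| ≤ C * lam n ∧ |(Nn n x) ^ 2 - (N₀ x) ^ 2| ≤ C * lam n)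
    -- O(1) bounds on first derivatives of ψₙ in L^∞(K)
    (hD1 : ∃ C : ℝ, ∀ n, ∀ α : Fin 3, ∀ x ∈ K, |pd α (ψ n) x| ≤ C)
    -- O(λₙ^{1/2}) bound on spatial derivatives of Nₙ² − N₀² on K
    (hspatial : ∃ C : ℝ, ∀ n, ∀ i : Fin 2, ∀ x ∈ K,
      |pd (sp i) (fun y => (Nn n y) ^ 2 - (N₀ y) ^ 2) x| ≤ C * Real.sqrt (lam n)) :
    Tendsto (fun n =>
      (∫ x : E3,
        ((e0 b₀ (fun y => χ y * ψ n y) x / N₀ x : ℝ) : ℂ) * ((b x : ℝ) : ℂ) *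
          ∑ i : Fin 2,
            ((((Nn n x) ^ 2 - (N₀ x) ^ 2 : ℝ) : ℂ)
                * FMul m (fun y =>
                    pd (sp i) (pd (sp i) (fun z => χ z * ψ n z)) y / N₀ y) x
              - FMul m (fun y => ((Nn n y) ^ 2 - (N₀ y) ^ 2)
                    * pd (sp i) (pd (sp i) (fun z => χ z * ψ n z)) y / N₀ y) x))
      - (∫ x : E3,
        ((e0 b₀ (fun y => χ y * (ψ n y - ψ₀ y)) x / N₀ x : ℝ) : ℂ) * ((b x : ℝ) : ℂ) *
          ∑ i : Fin 2,
            ((((Nn n x) ^ 2 - (N₀ x) ^ 2 : ℝ) : ℂ)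
                * FMul m (fun y =>
                    pd (sp i) (pd (sp i) (fun z => χ z * (ψ n z - ψ₀ z))) y / N₀ y) x
              - FMul m (fun y => ((Nn n y) ^ 2 - (N₀ y) ^ 2)
                    * pd (sp i) (pd (sp i) (fun z => χ z * (ψ n z - ψ₀ z))) y / N₀ y) x)))
      atTop (nhds 0) := by
  obtain ⟨C, hC⟩ := hclose
  obtain ⟨D₁, hD₁⟩ := hD1
  obtain ⟨C₂, hC₂⟩ := hspatial
  obtain ⟨Cm, hmC⟩ := hm.exists_abs_le
  have hmc : Continuous m := hm.1.continuous
  have hfin : ∀ {k : ℕ} {f : E3 → ℝ}, ContDiff ℝ (⊤ : ℕ∞) f → ContDiff ℝ k f :=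
    fun hf => hf.of_le (by exact_mod_cast le_top)
  set L := tsupport χ with hLdef
  have hL : IsCompact L := hχc.isCompact
  have hLK : ∀ x ∈ L, x ∈ K := fun x hx => interior_subset (hχK hx)
  have hN0 : ∀ x ∈ L, N₀ x ≠ 0 := fun x hx => (hc.trans_le (hN₀c x (hLK x hx))).ne'
  have hχL : SuppDiff 4 L χ := ⟨hfin hχ, subset_rfl⟩
  have hψ₀ : ContDiff ℝ 4 ψ₀ := hfin hlimreg.1
  have hN4 : ContDiff ℝ 4 N₀ := hfin hlimreg.2
  have hN3 : ContDiff ℝ 3 N₀ := hfin hlimreg.2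
  have hN2 : ContDiff ℝ 2 N₀ := hfin hlimreg.2
  have hb₀3 : ∀ i, ContDiff ℝ 3 (b₀ i) := fun i => hfin (hb₀ i)
  have hb3 : ContDiff ℝ 3 b := hfin hb
  set u₀ : E3 → ℝ := fun y => χ y * ψ₀ y
  set u : ℕ → E3 → ℝ := fun n y => χ y * ψ n y
  set v : ℕ → E3 → ℝ := fun n y => χ y * (ψ n y - ψ₀ y)
  set h : ℕ → E3 → ℝ := fun n y => Nn n y ^ 2 - N₀ y ^ 2
  have hu₀ : SuppDiff 4 L u₀ := hχL.mul_right hψ₀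
  have hu : ∀ n, SuppDiff 4 L (u n) := fun n => hχL.mul_right (hreg n).1
  have hv : ∀ n, SuppDiff 4 L (v n) := fun n => hχL.mul_right ((hreg n).1.sub hψ₀)
  have hh : ∀ n, ContDiff ℝ 4 (h n) := fun n => ((hreg n).2.pow 2).sub (hN4.pow 2)
  have huv : ∀ n, u n = fun y => v n y + u₀ y := fun n => by
    funext y; simp only [u, v, u₀]; ring
  have h14 : (1 : WithTop ℕ∞) ≤ 4 := by norm_num
  have h24 : (2 : WithTop ℕ∞) ≤ 4 := by norm_num
  have h23 : (2 : WithTop ℕ∞) ≤ 3 := by norm_num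
  have hAu₀ : SuppDiff 3 L (amplitude b₀ N₀ b u₀) := hu₀.amplitude hb₀3 hN3 hN0 hb3
  -- uniform bounds on first derivatives
  obtain ⟨Bχ, hBχ, hχb⟩ := exists_abs_le_of_continuousOn hL hχ.continuous.continuousOn
  obtain ⟨Bψ, hBψ, hψb⟩ := exists_abs_le_of_continuousOn hL hψ₀.continuous.continuousOn
  choose Bp hBp hpb using fun α => exists_abs_le_of_continuousOn hL
    (contDiff_pd hχL.1 (j := 3) (by norm_num) α).continuous.continuousOn
  choose Bu hBu hub using fun α => exists_abs_le_of_continuousOn hL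
    (hu₀.pd (j := 3) (by norm_num) α).1.continuous.continuousOn
  choose BH hBH hHb using fun i => exists_abs_le_of_continuousOn hL
    (hu₀.hessDiag hN2 hN0 i).1.continuous.continuousOn
  have hsum : ∀ {ι : Type} [Fintype ι] {B : ι → ℝ}, (∀ i, 0 ≤ B i) → ∀ i, B i ≤ ∑ j, B j :=
    fun hB i => Finset.single_le_sum (fun j _ => hB j) (Finset.mem_univ i)
  have hψn : ∀ n, ∀ x ∈ L, |ψ n x| ≤ Bψ + |C| := fun n x hx => by
    have h1 := (hC n x (hLK x hx)).1
    have h2 : C * lam n ≤ |C| := by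
      refine (mul_le_mul_of_nonneg_right (le_abs_self C) (hlam n).1.le).trans ?_
      exact mul_le_of_le_one_right (abs_nonneg C) (hlam n).2
    have h3 := abs_add_le (ψ₀ x) (ψ n x - ψ₀ x)
    rw [add_sub_cancel] at h3
    linarith [hψb x hx]
  set D := Bχ * |D₁| + (Bψ + |C|) * ∑ α, Bp α
  have hBps : 0 ≤ ∑ α, Bp α := Finset.sum_nonneg fun α _ => hBp α
  have hBus : 0 ≤ ∑ α, Bu α := Finset.sum_nonneg fun α _ => hBu α
  have hBHs : 0 ≤ ∑ i, BH i := Finset.sum_nonneg fun i _ => hBH i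
  have hD : 0 ≤ D := by positivity
  have hun : ∀ n α, ∀ x ∈ L, |pd α (u n) x| ≤ D := fun n α x hx => by
    rw [pd_mul ((hχL.1.of_le h14).differentiable one_ne_zero)
      (((hreg n).1.of_le h14).differentiable one_ne_zero)]
    refine (abs_add_le _ _).trans (add_le_add ?_ ?_)
    · rw [abs_mul]
      exact mul_le_mul (hχb x hx) ((hD₁ n α x (hLK x hx)).trans (le_abs_self _)) (abs_nonneg _) hBχ
    · rw [abs_mul]
      exact mul_le_mul (hψn n x hx) ((hpb α x hx).trans (hsum hBp α)) (abs_nonneg _)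
        (by positivity)
  have hvn : ∀ n α, ∀ x ∈ L, |pd α (v n) x| ≤ D + ∑ α, Bu α := fun n α x hx => by
    have h1 : pd α (u n) x = pd α (v n) x + pd α u₀ x := by
      rw [huv n, pd_add (((hv n).1.of_le h14).differentiable one_ne_zero)
        ((hu₀.1.of_le h14).differentiable one_ne_zero)]
    have h2 : pd α (v n) x = pd α (u n) x - pd α u₀ x := by rw [h1]; ring
    rw [h2]
    exact (abs_sub _ _).trans (add_le_add (hun n α x hx) ((hub α x hx).trans (hsum hBu α)))
  obtain ⟨M₁, hM₁, hamp⟩ := exists_abs_amplitude_le hL (fun i => (hb₀ i).continuous)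
    hN2.continuous hN0 hb.continuous
  obtain ⟨M₂, hM₂, hcomm⟩ := exists_norm_commForm_le hL hmc hmC
  choose M₃ hM₃ hcomm' using fun i : Fin 2 =>
    exists_norm_commForm_pd_div_le hL hmc hmC hAu₀ hN4 hN0 (sp i)
  have hs : ∀ n, 0 ≤ (|C| + |C₂|) * √(lam n) := fun n => by positivity
  have hhs : ∀ n, ∀ x ∈ L, |h n x| ≤ (|C| + |C₂|) * √(lam n) := fun n x hx => by
    refine (hC n x (hLK x hx)).2.trans ?_
    have h1 : lam n ≤ √(lam n) := Real.le_sqrt_of_sq_le (by nlinarith [(hlam n).1, (hlam n).2])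
    calc C * lam n ≤ |C| * √(lam n) :=
          mul_le_mul (le_abs_self C) h1 (hlam n).1.le (abs_nonneg C)
      _ ≤ _ := by gcongr; linarith [abs_nonneg C₂]
  have hhps : ∀ n i, ∀ x ∈ L, |pd (sp i) (h n) x| ≤ (|C| + |C₂|) * √(lam n) := fun n i x hx => by
    refine (hC₂ n i x (hLK x hx)).trans ?_
    gcongr
    linarith [abs_nonneg C, le_abs_self C₂]
  have key : ∀ n, (∑ i : Fin 2, commForm m (amplitude b₀ N₀ b (u n)) (h n) (hessDiag N₀ (u n) i))
      - (∑ i : Fin 2, commForm m (amplitude b₀ N₀ b (v n)) (h n) (hessDiag N₀ (v n) i)) =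
      ∑ i : Fin 2, (commForm m (amplitude b₀ N₀ b u₀) (h n) (hessDiag N₀ (u n) i)
        + commForm m (amplitude b₀ N₀ b (v n)) (h n) (hessDiag N₀ u₀ i)) := fun n => by
    rw [← Finset.sum_sub_distrib]
    refine Finset.sum_congr rfl fun i _ => ?_
    have hAv := ((hv n).amplitude hb₀3 hN3 hN0 hb3).of_le h23
    have hA : amplitude b₀ N₀ b (u n) = _ := (congrArg (amplitude b₀ N₀ b) (huv n)).trans
      (amplitude_add (((hv n).1.of_le h14).differentiable one_ne_zero)
        ((hu₀.1.of_le h14).differentiable one_ne_zero))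
    have hH : hessDiag N₀ (u n) i = _ := (congrArg (fun w => hessDiag N₀ w i) (huv n)).trans
      (hessDiag_add ((hv n).1.of_le h24) (hu₀.1.of_le h24) i)
    rw [hA, commForm_add_left hL hmc hmC hAv (hAu₀.of_le h23) ((hh n).of_le h24)
      ((hu n).hessDiag hN2 hN0 i), hH, commForm_add_right hL hmc hmC hAv ((hh n).of_le h24)
      ((hv n).hessDiag hN2 hN0 i) (hu₀.hessDiag hN2 hN0 i)]
    ring
  have hbound : ∀ n, ‖∑ i : Fin 2, (commForm m (amplitude b₀ N₀ b u₀) (h n) (hessDiag N₀ (u n) i)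
        + commForm m (amplitude b₀ N₀ b (v n)) (h n) (hessDiag N₀ u₀ i))‖ ≤
      (∑ i : Fin 2, (M₃ i * ((|C| + |C₂|) * D)
        + M₂ * (M₁ * (D + ∑ α, Bu α) * (|C| + |C₂|) * ∑ i, BH i))) * √(lam n) := fun n => by
    rw [Finset.sum_mul]
    refine norm_sum_le_of_le _ fun i _ => ?_
    refine (norm_add_le_of_le (hcomm' i (h n) (pd (sp i) (u n)) _ D (hs n) hD (hh n)
      ((hu n).pd (by norm_num) _) (hhs n) (hhps n i) (hun n (sp i)))
      (hcomm _ (h n) _ (M₁ * (D + ∑ α, Bu α)) _ (∑ i, BH i) (by positivity) (hs n) hBHs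
        (((hv n).amplitude hb₀3 hN3 hN0 hb3).of_le h23) ((hh n).of_le h24)
        (hu₀.hessDiag hN2 hN0 i) (hamp _ _ (by positivity) (hvn n)) (hhs n)
        fun x hx => (hHb i x hx).trans (hsum hBH i))).trans_eq (by ring)
  have hlim : Tendsto (fun n => (∑ i : Fin 2, (M₃ i * ((|C| + |C₂|) * D)
        + M₂ * (M₁ * (D + ∑ α, Bu α) * (|C| + |C₂|) * ∑ i, BH i))) * √(lam n))
      atTop (nhds 0) := by
    simpa using (hlam0.sqrt).const_mul _
  refine (squeeze_zero_norm hbound hlim).congr fun n => ?_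
  rw [← key n, ← integral_commutator_eq hL hmc hmC (hu n) hb₀3 hN3 hN0 hb3 (hh n),
    ← integral_commutator_eq hL hmc hmC (hv n) hb₀3 hN3 hN0 hb3 (hh n)]

end
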